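/- The collection of all sets of the form C(H,u), where H is a hyperplane of T and u ∈ V' satisfies r·u ∉ H, is a partition of V: every element of V lies in exactly one such set. Moreover, each set C(H,u) has cardinality q^{2e-1}, and the number of distinct sets C(H,u) equals (q^{2e}-1)/(q-1). -/

import Mathlib

open Matrix

/-- The symplectic form `a M bᵀ` where `M = [[0, Iₑ],[-Iₑ, 0]]`. -/
def sympForm (K : Type) [CommRing K] (e : ℕ) (a b : Fin e ⊕ Fin e → K) : K :=
  a ⬝ᵥ ((Matrix.fromBlocks (0 : Matrix (Fin e) (Fin e) K) 1 (-1) 0) *ᵥ b)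

/-- `V'`: the set of 2e-tuples over `K` having at least one unit entry. -/
def unitTuples (K : Type) [CommRing K] (e : ℕ) : Set (Fin e ⊕ Fin e → K) :=
  {a | ∃ i, IsUnit (a i)}

/-- The equivalence class `[a]` of a tuple under unit scaling. -/
def cls (K : Type) [CommRing K] (e : ℕ) (a : Fin e ⊕ Fin e → K) :
    Set (Fin e ⊕ Fin e → K) :=
  {b | ∃ σ : Kˣ, b = σ • a}

/-- `V`: the set of equivalence classes of elements of `V'` under unit scaling. -/
def classes (K : Type) [CommRing K] (e : ℕ) : Set (Set (Fin e ⊕ Fin e → K)) :=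
  {S | ∃ a ∈ unitTuples K e, S = cls K e a}

/-- Adjacency in the graph `X(2e,K)`: `a M bᵀ ∈ K \ {0}`. -/
def adjX (K : Type) [CommRing K] (e : ℕ) (A B : Set (Fin e ⊕ Fin e → K)) : Prop :=
  ∃ a ∈ A, ∃ b ∈ B, sympForm K e a b ≠ 0

/-- Adjacency in the complement of `X(2e,K)`: distinct classes with `a M bᵀ = 0`. -/
def adjXc (K : Type) [CommRing K] (e : ℕ) (A B : Set (Fin e ⊕ Fin e → K)) : Prop :=
  A ≠ B ∧ ∃ a ∈ A, ∃ b ∈ B, sympForm K e a b = 0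

/-- Adjacency in the graph `Y(2e,K)`: `a M bᵀ ∈ J \ {0}`. -/
def adjY (K : Type) [CommRing K] (J : Ideal K) (e : ℕ)
    (A B : Set (Fin e ⊕ Fin e → K)) : Prop :=
  ∃ a ∈ A, ∃ b ∈ B, sympForm K e a b ∈ J ∧ sympForm K e a b ≠ 0

/-- `T = J × ⋯ × J` (2e factors), as a subset of `K^{2e}`. -/
def Tset (K : Type) [CommRing K] (J : Ideal K) (e : ℕ) : Set (Fin e ⊕ Fin e → K) :=
  {x | ∀ i, x i ∈ J}

/-- A hyperplane of `T`: a `K`-submodule contained in `T` of cardinality `q^(2e-1)`. -/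
def IsHyperplane (K : Type) [CommRing K] (J : Ideal K) (e q : ℕ)
    (H : Submodule K (Fin e ⊕ Fin e → K)) : Prop :=
  (H : Set (Fin e ⊕ Fin e → K)) ⊆ Tset K J e ∧ Nat.card H = q ^ (2 * e - 1)

/-- `C(H,u) = {[u+h] : h ∈ H}`. -/
def classSet (K : Type) [CommRing K] (e : ℕ) (H : Submodule K (Fin e ⊕ Fin e → K))
    (u : Fin e ⊕ Fin e → K) : Set (Set (Fin e ⊕ Fin e → K)) :=
  {S | ∃ h ∈ (H : Set (Fin e ⊕ Fin e → K)), S = cls K e (u + h)}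

/-- The set of tuples `{σ • (u+h) : σ ∈ Kˣ, h ∈ H}`. -/
def orbitSet (K : Type) [CommRing K] (e : ℕ) (H : Submodule K (Fin e ⊕ Fin e → K))
    (u : Fin e ⊕ Fin e → K) : Set (Fin e ⊕ Fin e → K) :=
  {x | ∃ σ : Kˣ, ∃ h ∈ (H : Set (Fin e ⊕ Fin e → K)), x = σ • (u + h)}

/-- The coset `c • u + T` of `T`. -/
def cosetOf (K : Type) [CommRing K] (J : Ideal K) (e : ℕ) (c : K)
    (u : Fin e ⊕ Fin e → K) : Set (Fin e ⊕ Fin e → K) :=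
  {x | ∃ t ∈ Tset K J e, x = c • u + t}

/-- The fibre of the reduction `V → ℙ(K/J)` through `[u]`: all classes `[u + t]` with `t ∈ T`. -/
def fibreSet (K : Type) [CommRing K] (J : Ideal K) (e : ℕ) (u : Fin e ⊕ Fin e → K) :
    Set (Set (Fin e ⊕ Fin e → K)) :=
  {S | ∃ t ∈ Tset K J e, S = cls K e (u + t)}

section

variable {K : Type} [CommRing K] {J : Ideal K} {e : ℕ}

theorem cls_smul (σ : Kˣ) (a : Fin e ⊕ Fin e → K) : cls K e (σ • a) = cls K e a := by
  ext b
  constructor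
  · rintro ⟨τ, rfl⟩
    exact ⟨τ * σ, by rw [mul_smul]⟩
  · rintro ⟨τ, rfl⟩
    exact ⟨τ * σ⁻¹, by rw [mul_smul, inv_smul_smul]⟩

theorem exists_eq_smul_of_cls_eq {a b : Fin e ⊕ Fin e → K} (h : cls K e a = cls K e b) :
    ∃ σ : Kˣ, a = σ • b := by
  have ha : a ∈ cls K e a := ⟨1, (one_smul _ a).symm⟩
  rwa [h] at ha

theorem smul_mem_Tset (c : K) {t : Fin e ⊕ Fin e → K} (ht : t ∈ Tset K J e) :
    c • t ∈ Tset K J e :=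
  fun i => J.mul_mem_left c (ht i)

theorem self_mem_fibreSet (u : Fin e ⊕ Fin e → K) : cls K e u ∈ fibreSet K J e u :=
  ⟨0, fun _ => J.zero_mem, by rw [add_zero]⟩

theorem fibreSet_smul_add (σ : Kˣ) (u : Fin e ⊕ Fin e → K) {t : Fin e ⊕ Fin e → K}
    (ht : t ∈ Tset K J e) : fibreSet K J e (σ • (u + t)) = fibreSet K J e u := by
  ext S
  constructor
  · rintro ⟨s, hs, rfl⟩
    refine ⟨t + σ⁻¹ • s, fun i => J.add_mem (ht i) (smul_mem_Tset (σ⁻¹ : Kˣ).val hs i), ?_⟩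
    rw [← cls_smul σ (u + _), ← add_assoc, smul_add σ (u + t), smul_inv_smul]
  · rintro ⟨s, hs, rfl⟩
    refine ⟨σ • (s - t), smul_mem_Tset σ.val fun i => J.sub_mem (hs i) (ht i), ?_⟩
    rw [← smul_add, cls_smul]
    congr 1
    abel

theorem fibreSet_eq_iff {u v : Fin e ⊕ Fin e → K} :
    fibreSet K J e u = fibreSet K J e v ↔ ∃ σ : Kˣ, ∃ t ∈ Tset K J e, u = σ • (v + t) := by
  constructor
  · intro h
    obtain ⟨t, ht, h'⟩ := h ▸ self_mem_fibreSet (J := J) u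
    obtain ⟨σ, hσ⟩ := exists_eq_smul_of_cls_eq h'
    exact ⟨σ, t, ht, hσ⟩
  · rintro ⟨σ, t, ht, rfl⟩
    exact fibreSet_smul_add σ v ht

theorem isUnit_of_notMem (hideals : ∀ I : Ideal K, I = ⊥ ∨ I = J ∨ I = ⊤) {x : K}
    (hx : x ∉ J) : IsUnit x := by
  rw [← Ideal.span_singleton_eq_top]
  have hmem := Ideal.mem_span_singleton_self x
  rcases hideals (Ideal.span {x}) with h | h | h
  · rw [h, Ideal.mem_bot] at hmem
    exact absurd (hmem ▸ J.zero_mem) hx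
  · exact absurd (h ▸ hmem) hx
  · exact h

theorem isMaximal_of_isUnit (hJtop : J ≠ ⊤) (hunit : ∀ x ∉ J, IsUnit x) : J.IsMaximal := by
  refine ⟨hJtop, fun I hI => ?_⟩
  obtain ⟨x, hxI, hxJ⟩ := Set.exists_of_ssubset hI
  exact Ideal.eq_top_of_isUnit_mem I hxI (hunit x hxJ)

theorem mul_self_generator_eq_zero {r : K} (hJr : J = Ideal.span {r}) (hJtop : J ≠ ⊤)
    (hideals : ∀ I : Ideal K, I = ⊥ ∨ I = J ∨ I = ⊤) : r * r = 0 := by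
  have hr : r ∈ J := hJr ▸ Ideal.mem_span_singleton_self r
  have hle : Ideal.span {r * r} ≤ J := by
    rw [Ideal.span_singleton_le_iff_mem]
    exact J.mul_mem_left r hr
  rcases hideals (Ideal.span {r * r}) with h | h | h
  · exact Ideal.span_singleton_eq_bot.1 h
  · rw [← h, Ideal.mem_span_singleton'] at hr
    obtain ⟨a, ha⟩ := hr
    have hu : IsUnit (1 - a * r) := by
      refine isUnit_of_notMem hideals fun hmem => hJtop ?_
      rw [Ideal.eq_top_iff_one]
      have := J.add_mem hmem (J.mul_mem_left a (hJr ▸ Ideal.mem_span_singleton_self r : r ∈ J))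
      simpa using this
    have : (1 - a * r) * r = 0 := by linear_combination -ha
    rw [(hu.mul_right_eq_zero).1 this, mul_zero]
  · exact absurd (top_le_iff.1 (h ▸ hle)) hJtop

theorem mul_eq_zero_of_mem {r : K} (hJr : J = Ideal.span {r}) (hrr : r * r = 0) {x y : K}
    (hx : x ∈ J) (hy : y ∈ J) : x * y = 0 := by
  rw [hJr, Ideal.mem_span_singleton'] at hx hy
  obtain ⟨a, rfl⟩ := hx
  obtain ⟨b, rfl⟩ := hy
  linear_combination a * b * hrr

theorem card_ideal_eq_card_quotient {r : K} (hJr : J = Ideal.span {r}) (hr : r ≠ 0)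
    (hrr : r * r = 0) (hunit : ∀ x ∉ J, IsUnit x) : Nat.card J = Nat.card (K ⧸ J) := by
  have hker : LinearMap.ker (LinearMap.toSpanSingleton K K r) = J := by
    ext x
    rw [LinearMap.mem_ker, LinearMap.toSpanSingleton_apply, smul_eq_mul]
    constructor
    · intro h
      by_contra hx
      exact hr ((hunit x hx).mul_right_eq_zero.1 h)
    · intro h
      exact mul_eq_zero_of_mem hJr hrr h (hJr ▸ Ideal.mem_span_singleton_self r)
  have hrange : LinearMap.range (LinearMap.toSpanSingleton K K r) = J := by
    rw [LinearMap.range_toSpanSingleton, hJr]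
  have := Nat.card_congr (LinearMap.toSpanSingleton K K r).quotKerEquivRange.toEquiv
  rw [hker, hrange] at this
  exact this.symm

theorem card_Tset : Nat.card (Tset K J e) = Nat.card J ^ (2 * e) := by
  refine (Nat.card_congr
    (Equiv.subtypePiEquivPi (p := fun (_ : Fin e ⊕ Fin e) x => x ∈ J))).trans ?_
  rw [Nat.card_pi]
  simp [two_mul]

/-- The elements of `T` whose `i`-th coordinate vanishes. -/
def coordHyperplane (J : Ideal K) (i : Fin e ⊕ Fin e) : Submodule K (Fin e ⊕ Fin e → K) :=
  Submodule.pi Set.univ fun j => if j = i then ⊥ else J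

theorem isHyperplane_coordHyperplane {q : ℕ} (hcard : Nat.card J = q) (i : Fin e ⊕ Fin e) :
    IsHyperplane K J e q (coordHyperplane J i) := by
  constructor
  · intro t ht j
    have : t j ∈ (if j = i then ⊥ else J : Ideal K) := ht j (Set.mem_univ j)
    split_ifs at this with hj
    · exact (Submodule.mem_bot K).1 this ▸ J.zero_mem
    · exact this
  · let e₁ : coordHyperplane J i ≃
        {f : Fin e ⊕ Fin e → K // ∀ j, f j ∈ (if j = i then ⊥ else J : Ideal K)} :=
      Equiv.subtypeEquivRight fun f => by simp [coordHyperplane, Submodule.mem_pi]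
    rw [Nat.card_congr (e₁.trans (Equiv.subtypePiEquivPi
        (p := fun j x => x ∈ (if j = i then ⊥ else J : Ideal K)))), Nat.card_pi,
      Fintype.prod_eq_mul_prod_compl i,
      Finset.prod_congr rfl (g := fun _ => q) fun j hj => ?_]
    · simp [Finset.card_compl, two_mul]
    · have hj : j ≠ i := by simpa using hj
      simp [hj, hcard]

theorem smul_notMem_coordHyperplane {r : K} (hr : r ≠ 0) {u : Fin e ⊕ Fin e → K}
    {i : Fin e ⊕ Fin e} (hi : IsUnit (u i)) : r • u ∉ coordHyperplane J i := by
  intro h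
  have h : r * u i ∈ (if i = i then ⊥ else J : Ideal K) := h i (Set.mem_univ i)
  rw [if_pos rfl, Ideal.mem_bot] at h
  exact hr (hi.mul_left_eq_zero.1 h)

theorem eq_zero_of_smul_mem {r : K} (hJr : J = Ideal.span {r}) (hrr : r * r = 0)
    (hunit : ∀ x ∉ J, IsUnit x) {H : Submodule K (Fin e ⊕ Fin e → K)}
    {u : Fin e ⊕ Fin e → K} (hru : r • u ∉ H) {j : K} (hj : j ∈ J) (hju : j • u ∈ H) :
    j = 0 := by
  obtain ⟨s, rfl⟩ := Ideal.mem_span_singleton'.1 (hJr ▸ hj)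
  by_cases hs : s ∈ J
  · exact mul_eq_zero_of_mem hJr hrr hs (hJr ▸ Ideal.mem_span_singleton_self r)
  · rw [mul_smul] at hju
    exact absurd ((Submodule.smul_mem_iff_of_isUnit H (hunit s hs)).1 hju) hru

theorem exists_add_smul_of_mem_Tset [Finite K] {r : K} {q : ℕ} (hJr : J = Ideal.span {r})
    (hrr : r * r = 0) (hunit : ∀ x ∉ J, IsUnit x) (hcard : Nat.card J = q) (he : 1 ≤ e)
    {H : Submodule K (Fin e ⊕ Fin e → K)} (hH : IsHyperplane K J e q H)
    {u : Fin e ⊕ Fin e → K} (hru : r • u ∉ H) {t : Fin e ⊕ Fin e → K}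
    (ht : t ∈ Tset K J e) : ∃ h ∈ H, ∃ j ∈ J, t = h + j • u := by
  let f : H × J → Tset K J e := fun p =>
    ⟨p.1 + p.2.val • u, fun i => J.add_mem (hH.1 p.1.2 i) (J.mul_mem_right _ p.2.2)⟩
  have hf : Function.Injective f := by
    rintro ⟨h, j⟩ ⟨h', j'⟩ hp
    have hp : h.val + j.val • u = h'.val + j'.val • u := congrArg Subtype.val hp
    have hj : j.val - j'.val = 0 := by
      refine eq_zero_of_smul_mem hJr hrr hunit hru (J.sub_mem j.2 j'.2) ?_
      have : (j.val - j'.val) • u = h'.val - h.val := by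
        rw [sub_smul, sub_eq_sub_iff_add_eq_add, add_comm, hp, add_comm]
      rw [this]
      exact H.sub_mem h'.2 h.2
    have hj : j = j' := Subtype.ext (sub_eq_zero.1 hj)
    subst hj
    have hh : h = h' := Subtype.ext (add_right_cancel hp)
    rw [hh]
  have hc : Nat.card (H × J) = Nat.card (Tset K J e) := by
    rw [Nat.card_prod, hH.2, card_Tset, hcard, ← pow_succ]
    congr 1
    omega
  obtain ⟨⟨h, j⟩, hp⟩ := ((Nat.bijective_iff_injective_and_card f).2 ⟨hf, hc⟩).2 ⟨t, ht⟩
  exact ⟨h, h.2, j, j.2, (congrArg Subtype.val hp).symm⟩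

theorem isUnit_one_add {j : K} (hsq : j * j = 0) : IsUnit (1 + j) :=
  IsUnit.of_mul_eq_one (1 - j) (by linear_combination -hsq)

theorem classSet_eq_fibreSet [Finite K] {r : K} {q : ℕ} (hJr : J = Ideal.span {r})
    (hrr : r * r = 0) (hunit : ∀ x ∉ J, IsUnit x) (hcard : Nat.card J = q) (he : 1 ≤ e)
    {H : Submodule K (Fin e ⊕ Fin e → K)} (hH : IsHyperplane K J e q H)
    {u : Fin e ⊕ Fin e → K} (hru : r • u ∉ H) :
    classSet K e H u = fibreSet K J e u := by
  ext S
  constructor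
  · rintro ⟨h, hh, rfl⟩
    exact ⟨h, hH.1 hh, rfl⟩
  · rintro ⟨t, ht, rfl⟩
    obtain ⟨h, hh, j, hj, rfl⟩ :=
      exists_add_smul_of_mem_Tset hJr hrr hunit hcard he hH hru ht
    obtain ⟨σ, hσ⟩ := isUnit_one_add (mul_eq_zero_of_mem hJr hrr hj hj)
    refine ⟨σ⁻¹ • h, H.smul_mem (σ⁻¹ : Kˣ).val hh, ?_⟩
    rw [← cls_smul σ (u + σ⁻¹ • h), smul_add, smul_inv_smul, Units.smul_def, hσ, add_smul, one_smul]
    congr 1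
    abel

theorem card_classSet {r : K} (hJr : J = Ideal.span {r}) (hrr : r * r = 0)
    (hunit : ∀ x ∉ J, IsUnit x) {H : Submodule K (Fin e ⊕ Fin e → K)}
    (hHT : (H : Set (Fin e ⊕ Fin e → K)) ⊆ Tset K J e) {u : Fin e ⊕ Fin e → K}
    (hu : u ∈ unitTuples K e) (hru : r • u ∉ H) :
    Nat.card (classSet K e H u) = Nat.card H := by
  symm
  refine Nat.card_congr (Equiv.ofBijective
    (fun h : H => (⟨cls K e (u + h), h, h.2, rfl⟩ : classSet K e H u)) ⟨?_, ?_⟩)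
  · intro h h' hh
    obtain ⟨σ, hσ⟩ := exists_eq_smul_of_cls_eq (congrArg Subtype.val hh)
    obtain ⟨i, hi⟩ := hu
    have hval : ∀ k, u k + h.val k = σ * (u k + h'.val k) := fun k => congrFun hσ k
    have hj : σ.val - 1 ∈ J := by
      rw [← Ideal.mul_unit_mem_iff_mem J hi]
      have : (σ.val - 1) * u i = h.val i - σ * h'.val i := by linear_combination -hval i
      rw [this]
      exact J.sub_mem (hHT h.2 i) (J.mul_mem_left _ (hHT h'.2 i))
    have hju : (σ.val - 1) • u ∈ H := by
      have : (σ.val - 1) • u = h.val - σ.val • h'.val := by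
        ext k
        simp only [Pi.smul_apply, Pi.sub_apply, smul_eq_mul]
        linear_combination -hval k
      rw [this]
      exact H.sub_mem h.2 (H.smul_mem _ h'.2)
    have h1 : σ.val = 1 := sub_eq_zero.1 (eq_zero_of_smul_mem hJr hrr hunit hru hj hju)
    ext k
    have := hval k
    rw [h1, one_mul] at this
    exact add_left_cancel this
  · rintro ⟨_, h, hh, rfl⟩
    exact ⟨⟨h, hh⟩, rfl⟩

theorem comp_mk_ne_zero (hJtop : J ≠ ⊤) {u : Fin e ⊕ Fin e → K} (hu : u ∈ unitTuples K e) :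
    (fun i => Ideal.Quotient.mk J (u i)) ≠ 0 := by
  obtain ⟨i, hi⟩ := hu
  intro h
  exact hJtop (Ideal.eq_top_of_isUnit_mem J (Ideal.Quotient.eq_zero_iff_mem.1 (congrFun h i)) hi)

theorem card_range_fibreSet [Finite K] (hJtop : J ≠ ⊤) (hunit : ∀ x ∉ J, IsUnit x) :
    Nat.card (Set.range fun u : unitTuples K e => fibreSet K J e u) =
      (Nat.card (K ⧸ J) ^ (2 * e) - 1) / (Nat.card (K ⧸ J) - 1) := by
  have := isMaximal_of_isUnit hJtop hunit
  have : Finite (K ⧸ J) := Finite.of_surjective _ Ideal.Quotient.mk_surjective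
  let : Field (K ⧸ J) := Ideal.Quotient.field J
  let F : unitTuples K e → Projectivization (K ⧸ J) (Fin e ⊕ Fin e → K ⧸ J) := fun u =>
    Projectivization.mk (K ⧸ J) _ (comp_mk_ne_zero hJtop u.2)
  have hF : Function.Surjective F := by
    intro p
    induction p with
    | h v hv =>
      choose w hw using fun i => Ideal.Quotient.mk_surjective (v i)
      obtain ⟨i, hi⟩ := Function.ne_iff.1 hv
      have hw' : w ∈ unitTuples K e :=
        ⟨i, hunit _ fun h => hi ((hw i).symm.trans (Ideal.Quotient.eq_zero_iff_mem.2 h))⟩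
      refine ⟨⟨w, hw'⟩, ?_⟩
      simp only [F, hw]
  have hFG : ∀ u v : unitTuples K e,
      F u = F v ↔ fibreSet K J e u = fibreSet K J e v := by
    intro u v
    rw [fibreSet_eq_iff, Projectivization.mk_eq_mk_iff']
    constructor
    · rintro ⟨a, ha⟩
      obtain ⟨s, rfl⟩ := Ideal.Quotient.mk_surjective a
      have hs : s ∉ J := by
        intro hs
        refine comp_mk_ne_zero hJtop u.2 ?_
        rw [← ha, Ideal.Quotient.eq_zero_iff_mem.2 hs, zero_smul]
      obtain ⟨σ, rfl⟩ := hunit s hs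
      have hT : u.val - σ.val • v.val ∈ Tset K J e := fun i => by
        refine (Ideal.Quotient.eq (I := J)).1 ?_
        have := congrFun ha i
        simp only [Pi.smul_apply, smul_eq_mul] at this ⊢
        rw [map_mul, this]
      refine ⟨σ, σ⁻¹ • (u.val - σ.val • v.val), smul_mem_Tset (σ⁻¹ : Kˣ).val hT, ?_⟩
      rw [smul_add, smul_inv_smul, Units.smul_def, add_sub_cancel]
    · rintro ⟨σ, t, ht, hut⟩
      refine ⟨Ideal.Quotient.mk J σ, ?_⟩
      ext i
      have hi : u.val i = σ.val * (v.val i + t i) := congrFun hut i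
      simp only [Pi.smul_apply, smul_eq_mul, hi, map_mul, map_add,
        Ideal.Quotient.eq_zero_iff_mem.2 (ht i), add_zero]
  have hcard : Nat.card (Set.range fun u : unitTuples K e => fibreSet K J e u) =
      Nat.card (Projectivization (K ⧸ J) (Fin e ⊕ Fin e → K ⧸ J)) := by
    refine Nat.card_congr ((Setoid.quotientKerEquivRange _).symm.trans
      ((Quotient.congrRight fun u v => ?_).trans (Setoid.quotientKerEquivOfSurjective F hF)))
    rw [Setoid.ker_def, Setoid.ker_def, hFG]
  rw [hcard, Projectivization.card'']
  simp [Nat.card_pi, two_mul]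

end

/-- Corollary: the sets `C(H,u)` form a partition of `V` into `(q^(2e)-1)/(q-1)`
classes of size `q^(2e-1)`. -/
theorem classSet_partition
    (K : Type) [CommRing K] [Fintype K]
    (J : Ideal K) (r : K) (q : ℕ)
    (hJr : J = Ideal.span {r})
    (hJbot : J ≠ ⊥) (hJtop : J ≠ ⊤)
    (hideals : ∀ I : Ideal K, I = ⊥ ∨ I = J ∨ I = ⊤)
    (hq : IsPrimePow q)
    (hqcard : Nat.card (K ⧸ J) = q)
    (e : ℕ) (he : 2 ≤ e) :
    (∀ A ∈ classes K e, ∃! S : Set (Set (Fin e ⊕ Fin e → K)),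
      (∃ H : Submodule K (Fin e ⊕ Fin e → K), ∃ u ∈ unitTuples K e,
        IsHyperplane K J e q H ∧ r • u ∉ H ∧ S = classSet K e H u) ∧ A ∈ S) ∧
    (∀ H : Submodule K (Fin e ⊕ Fin e → K), ∀ u ∈ unitTuples K e,
      IsHyperplane K J e q H → r • u ∉ H →
        Nat.card (classSet K e H u) = q ^ (2 * e - 1)) ∧
    Nat.card ↥{S : Set (Set (Fin e ⊕ Fin e → K)) |
        ∃ H : Submodule K (Fin e ⊕ Fin e → K), ∃ u ∈ unitTuples K e,
          IsHyperplane K J e q H ∧ r • u ∉ H ∧ S = classSet K e H u} =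
      (q ^ (2 * e) - 1) / (q - 1) := by
  have hr : r ≠ 0 := by
    rintro rfl
    exact hJbot (by rw [hJr, Ideal.span_singleton_eq_bot])
  have hunit : ∀ x ∉ J, IsUnit x := fun x => isUnit_of_notMem hideals
  have hrr := mul_self_generator_eq_zero hJr hJtop hideals
  have hcard : Nat.card J = q := (card_ideal_eq_card_quotient hJr hr hrr hunit).trans hqcard
  have he' : 1 ≤ e := by omega
  have hfibre : ∀ {H : Submodule K (Fin e ⊕ Fin e → K)} {u : Fin e ⊕ Fin e → K},
      IsHyperplane K J e q H → r • u ∉ H → classSet K e H u = fibreSet K J e u :=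
    fun hH hru => classSet_eq_fibreSet hJr hrr hunit hcard he' hH hru
  have hexists : ∀ u ∈ unitTuples K e, ∃ H : Submodule K (Fin e ⊕ Fin e → K),
      IsHyperplane K J e q H ∧ r • u ∉ H := fun u ⟨i, hi⟩ =>
    ⟨coordHyperplane J i, isHyperplane_coordHyperplane hcard i, smul_notMem_coordHyperplane hr hi⟩
  refine ⟨?_, ?_, ?_⟩
  · rintro A ⟨a, ha, rfl⟩
    obtain ⟨H, hH, hra⟩ := hexists a ha
    refine ⟨fibreSet K J e a, ⟨⟨H, a, ha, hH, hra, (hfibre hH hra).symm⟩,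
      self_mem_fibreSet a⟩, ?_⟩
    rintro S ⟨⟨H', u, -, hH', hru, rfl⟩, hmem⟩
    rw [hfibre hH' hru] at hmem ⊢
    obtain ⟨t, ht, h⟩ := hmem
    obtain ⟨σ, hσ⟩ := exists_eq_smul_of_cls_eq h
    exact (fibreSet_eq_iff.2 ⟨σ, t, ht, hσ⟩).symm
  · intro H u hu hH hru
    rw [card_classSet hJr hrr hunit hH.1 hu hru, hH.2]
  · rw [← hqcard, ← card_range_fibreSet hJtop hunit, hqcard]
    congr 2
    ext S
    constructor
    · rintro ⟨H, u, hu, hH, hru, rfl⟩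
      exact ⟨⟨u, hu⟩, (hfibre hH hru).symm⟩
    · rintro ⟨⟨u, hu⟩, rfl⟩
      obtain ⟨H, hH, hru⟩ := hexists u hu
      exact ⟨H, u, hu, hH, hru, (hfibre hH hru).symm⟩
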